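/- For every nonnegative integer n, b̅₅(25n+72) = 6·b̅₅(5n+12) − 5·b̅₅(n). -/

import Mathlib

open scoped BigOperators

/-- The q-Pochhammer infinite product `(a; q)_∞ = ∏_{k≥0} (1 - a q^k)`. -/
noncomputable def qpoch (a q : ℂ) : ℂ := ∏' k : ℕ, (1 - a * q ^ k)

/-- `φ(-q) = (q;q)_∞² / (q²;q²)_∞`. -/
noncomputable def phiNeg (q : ℂ) : ℂ := qpoch q q ^ 2 / qpoch (q ^ 2) (q ^ 2)

/-- `ψ(-q) = (q;q)_∞ (q⁴;q⁴)_∞ / (q²;q²)_∞`. -/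
noncomputable def psiNeg (q : ℂ) : ℂ :=
  qpoch q q * qpoch (q ^ 4) (q ^ 4) / qpoch (q ^ 2) (q ^ 2)

/-- partial products -/
noncomputable def EP (q : ℂ) (n : ℕ) : ℂ := ∏ k ∈ Finset.range n, (1 - q * q ^ k)

lemma EP_succ (q : ℂ) (n : ℕ) : EP q (n + 1) = EP q n * (1 - q * q ^ n) := by
  simp [EP, Finset.prod_range_succ]

lemma summable_geo {q : ℂ} (hq : ‖q‖ < 1) : Summable (fun k : ℕ => ‖-(q * q ^ k)‖) := by
  simp only [norm_neg, norm_mul, norm_pow]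
  exact (summable_geometric_of_lt_one (norm_nonneg _) hq).mul_left _

lemma one_sub_ne {q : ℂ} (hq : ‖q‖ < 1) (k : ℕ) : 1 - q * q ^ k ≠ 0 := by
  intro h
  have h1 : q ^ (k + 1) = 1 := by rw [pow_succ']; linear_combination -h
  have h2 : ‖q‖ ^ (k + 1) = 1 := by rw [← norm_pow, h1]; simp
  have := pow_lt_one₀ (norm_nonneg q) hq (Nat.succ_ne_zero k)
  simp at this
  linarith

lemma qpoch_ne {q : ℂ} (hq : ‖q‖ < 1) : qpoch q q ≠ 0 := by
  have := tprod_one_add_ne_zero_of_summable (f := fun k : ℕ => -(q * q ^ k))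
    (fun k => by simpa [sub_eq_add_neg] using one_sub_ne hq k) (summable_geo hq)
  simpa [qpoch, sub_eq_add_neg] using this

lemma EP_tendsto {q : ℂ} (hq : ‖q‖ < 1) :
    Filter.Tendsto (EP q) Filter.atTop (nhds (qpoch q q)) := by
  have := (multipliable_one_add_of_summable (f := fun k : ℕ => -(q * q ^ k))
    (summable_geo hq)).hasProd.tendsto_prod_nat
  change Filter.Tendsto (fun n => ∏ k ∈ Finset.range n, (1 - q * q ^ k)) _ _
  simpa [qpoch, sub_eq_add_neg] using this

lemma EP_ne {q : ℂ} (hq : ‖q‖ < 1) (n : ℕ) : EP q n ≠ 0 :=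
  Finset.prod_ne_zero_iff.mpr fun k _ => one_sub_ne hq k

lemma norm_pow_lt {q : ℂ} (hq : ‖q‖ < 1) (n : ℕ) (hn : n ≠ 0) : ‖q ^ n‖ < 1 := by
  rw [norm_pow]; exact pow_lt_one₀ (norm_nonneg q) hq hn

lemma psiNeg_ne {q : ℂ} (hq : ‖q‖ < 1) : psiNeg q ≠ 0 := by
  unfold psiNeg
  exact div_ne_zero (mul_ne_zero (qpoch_ne hq) (qpoch_ne (norm_pow_lt hq 4 (by norm_num))))
    (qpoch_ne (norm_pow_lt hq 2 (by norm_num)))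

/-- fifth root of unity relations -/
lemma cyc {z : ℂ} (hz : IsPrimitiveRoot z 5) : 1 + z + z ^ 2 + z ^ 3 + z ^ 4 = 0 := by
  have := hz.geom_sum_eq_zero (by norm_num)
  simpa [Finset.sum_range_succ] using this

lemma prod_cyc {w x : ℂ} (hw : 1 + w + w ^ 2 + w ^ 3 + w ^ 4 = 0) :
    (1 - x) * (1 - w * x) * (1 - w ^ 2 * x) * (1 - w ^ 3 * x) * (1 - w ^ 4 * x) = 1 - x ^ 5 := by
  have h5 : w ^ 5 = 1 := by linear_combination (w - 1) * hw
  have h6 : w ^ 6 = w := by linear_combination w * h5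
  have h7 : w ^ 7 = w ^ 2 := by linear_combination w ^ 2 * h5
  have h8 : w ^ 8 = w ^ 3 := by linear_combination w ^ 3 * h5
  have h9 : w ^ 9 = w ^ 4 := by linear_combination w ^ 4 * h5
  have h10 : w ^ 10 = 1 := by linear_combination (w ^ 5 + 1) * h5
  ring_nf
  simp only [h5, h6, h7, h8, h9, h10]
  have h4 : w ^ 4 = -1 - w - w ^ 2 - w ^ 3 := by linear_combination hw
  rw [h4]
  ring

lemma normE {z : ℂ} (hz : IsPrimitiveRoot z 5) (q : ℂ) (n : ℕ) :
    (EP q (5 * n) * EP (z * q) (5 * n) * EP (z ^ 2 * q) (5 * n) * EP (z ^ 3 * q) (5 * n)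
      * EP (z ^ 4 * q) (5 * n)) * EP (q ^ 25) n = EP (q ^ 5) (5 * n) * EP (q ^ 5) n ^ 5 := by
  induction n with
  | zero => simp [EP]
  | succ n ih =>
    have hz5 : z ^ 5 = 1 := hz.pow_eq_one
    have key : ∀ k : ℕ, (1 + z ^ (k+1) + (z ^ (k+1)) ^ 2 + (z ^ (k+1)) ^ 3 + (z ^ (k+1)) ^ 4 = 0) →
        (1 - q * q ^ k) * (1 - (z * q) * (z * q) ^ k) * (1 - (z ^ 2 * q) * (z ^ 2 * q) ^ k) *
        (1 - (z ^ 3 * q) * (z ^ 3 * q) ^ k) * (1 - (z ^ 4 * q) * (z ^ 4 * q) ^ k)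
        = 1 - q ^ 5 * (q ^ 5) ^ k := by
      intro k hk
      have := prod_cyc (x := q ^ (k + 1)) hk
      convert this using 1 <;> ring
    have hn : ∀ r : ℕ, ¬ (5 ∣ r) → 
        1 + z ^ (5 * n + r) + (z ^ (5 * n + r)) ^ 2 + (z ^ (5 * n + r)) ^ 3 
          + (z ^ (5 * n + r)) ^ 4 = 0 := by
      intro r hr
      apply cyc
      apply hz.pow_of_coprime
      rw [Nat.coprime_comm]
      apply (Nat.Prime.coprime_iff_not_dvd (by norm_num)).mpr
      omega
    have k0 := key (5 * n) (hn 1 (by norm_num))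
    have k1 := key (5 * n + 1) (hn 2 (by norm_num))
    have k2 := key (5 * n + 2) (hn 3 (by norm_num))
    have k3 := key (5 * n + 3) (hn 4 (by norm_num))
    have zz : ∀ m : ℕ, (z ^ m * q) * (z ^ m * q) ^ (5 * n + 4) = q ^ (5 * (n + 1)) := by
      intro m
      have : (z ^ m * q) * (z ^ m * q) ^ (5 * n + 4) = (z ^ 5) ^ (m * (n + 1)) * q ^ (5 * (n + 1)) := by
        ring
      rw [this, hz5]; simp
    have z0 : q * q ^ (5 * n + 4) = q ^ (5 * (n + 1)) := by ring
    have z1 : (z * q) * (z * q) ^ (5 * n + 4) = q ^ (5 * (n + 1)) := by simpa using zz 1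
    have e : 5 * (n + 1) = 5 * n + 1 + 1 + 1 + 1 + 1 := by ring
    rw [e]
    simp only [EP_succ]
    rw [show 5 * n + 1 + 1 = 5 * n + 2 by ring, show 5 * n + 2 + 1 = 5 * n + 3 by ring,
      show 5 * n + 3 + 1 = 5 * n + 4 by ring, z0, z1, zz 2, zz 3, zz 4]
    rw [← k0, ← k1, ← k2, ← k3]
    rw [show q ^ 5 * (q ^ 5) ^ (5 * n + 4) = q ^ 25 * (q ^ 25) ^ n by ring,
      show q ^ 5 * (q ^ 5) ^ n = q ^ (5 * (n + 1)) by ring]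
    generalize 1 - q ^ 25 * (q ^ 25) ^ n = u at *
    generalize 1 - q ^ (5 * (n + 1)) = v at *
    generalize EP (q ^ 5) (5 * n) = L at *
    generalize EP (q ^ 5) n = L' at *
    generalize EP (q ^ 25) n = Lbb at *
    generalize EP (q) (5 * n) = M0 at *
    generalize EP (z * q) (5 * n) = M1 at *
    generalize EP (z ^ 2 * q) (5 * n) = M2 at *
    generalize EP (z ^ 3 * q) (5 * n) = M3 at *
    generalize EP (z ^ 4 * q) (5 * n) = M4 at *
    clear k0 k1 k2 k3 key hn zz z0 z1 e
    generalize (1 - q * q ^ (5 * n)) = a0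
    generalize (1 - q * q ^ (5 * n + 1)) = a1
    generalize (1 - q * q ^ (5 * n + 2)) = a2
    generalize (1 - q * q ^ (5 * n + 3)) = a3
    generalize (1 - (z * q) * (z * q) ^ (5 * n)) = b0
    generalize (1 - (z * q) * (z * q) ^ (5 * n + 1)) = b1
    generalize (1 - (z * q) * (z * q) ^ (5 * n + 2)) = b2
    generalize (1 - (z * q) * (z * q) ^ (5 * n + 3)) = b3
    generalize (1 - (z ^ 2 * q) * (z ^ 2 * q) ^ (5 * n)) = c0
    generalize (1 - (z ^ 2 * q) * (z ^ 2 * q) ^ (5 * n + 1)) = c1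
    generalize (1 - (z ^ 2 * q) * (z ^ 2 * q) ^ (5 * n + 2)) = c2
    generalize (1 - (z ^ 2 * q) * (z ^ 2 * q) ^ (5 * n + 3)) = c3
    generalize (1 - (z ^ 3 * q) * (z ^ 3 * q) ^ (5 * n)) = d0
    generalize (1 - (z ^ 3 * q) * (z ^ 3 * q) ^ (5 * n + 1)) = d1
    generalize (1 - (z ^ 3 * q) * (z ^ 3 * q) ^ (5 * n + 2)) = d2
    generalize (1 - (z ^ 3 * q) * (z ^ 3 * q) ^ (5 * n + 3)) = d3
    generalize (1 - (z ^ 4 * q) * (z ^ 4 * q) ^ (5 * n)) = e0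
    generalize (1 - (z ^ 4 * q) * (z ^ 4 * q) ^ (5 * n + 1)) = e1
    generalize (1 - (z ^ 4 * q) * (z ^ 4 * q) ^ (5 * n + 2)) = e2
    generalize (1 - (z ^ 4 * q) * (z ^ 4 * q) ^ (5 * n + 3)) = e3
    linear_combination (u * v ^ 5 * a0 * a1 * a2 * a3 * b0 * b1 * b2 * b3 * c0 * c1 * c2 * c3
      * d0 * d1 * d2 * d3 * e0 * e1 * e2 * e3) * ih

lemma norm_rot {z : ℂ} (hz : IsPrimitiveRoot z 5) (m : ℕ) (q : ℂ) : ‖z ^ m * q‖ = ‖q‖ := by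
  rw [norm_mul, norm_pow, hz.norm'_eq_one (by norm_num)]; simp

lemma normQ {z : ℂ} (hz : IsPrimitiveRoot z 5) {q : ℂ} (hq : ‖q‖ < 1) :
    (qpoch q q * qpoch (z * q) (z * q) * qpoch (z ^ 2 * q) (z ^ 2 * q)
      * qpoch (z ^ 3 * q) (z ^ 3 * q) * qpoch (z ^ 4 * q) (z ^ 4 * q)) * qpoch (q ^ 25) (q ^ 25)
      = qpoch (q ^ 5) (q ^ 5) ^ 6 := by
  have h5 : Filter.Tendsto (fun n : ℕ => 5 * n) Filter.atTop Filter.atTop :=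
    Filter.tendsto_id.const_mul_atTop' (by norm_num)
  have t : ∀ m, Filter.Tendsto (fun n => EP (z ^ m * q) (5 * n)) Filter.atTop
      (nhds (qpoch (z ^ m * q) (z ^ m * q))) := fun m =>
    (EP_tendsto (by rw [norm_rot hz]; exact hq)).comp h5
  have t0 := t 0
  have t1 := t 1
  simp only [pow_zero, one_mul, pow_one] at t0 t1
  have L := ((((t0.mul t1).mul (t 2)).mul (t 3)).mul (t 4)).mul
    (EP_tendsto (norm_pow_lt hq 25 (by norm_num)))
  have R := ((EP_tendsto (norm_pow_lt hq 5 (by norm_num))).comp h5).mul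
    ((EP_tendsto (norm_pow_lt hq 5 (by norm_num))).pow 5)
  have := tendsto_nhds_unique (L.congr (fun n => normE hz q n)) R
  rw [this]; ring

lemma normPsi {z : ℂ} (hz : IsPrimitiveRoot z 5) {q : ℂ} (hq : ‖q‖ < 1) :
    (psiNeg q * psiNeg (z * q) * psiNeg (z ^ 2 * q) * psiNeg (z ^ 3 * q) * psiNeg (z ^ 4 * q))
      * psiNeg (q ^ 25) = psiNeg (q ^ 5) ^ 6 := by
  have hz2 : IsPrimitiveRoot (z ^ 2) 5 := hz.pow_of_coprime 2 (by norm_num)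
  have hz4 : IsPrimitiveRoot (z ^ 4) 5 := hz.pow_of_coprime 4 (by norm_num)
  have a1 := normQ hz hq
  have a2 := normQ hz2 (norm_pow_lt hq 2 (by norm_num))
  have a4 := normQ hz4 (norm_pow_lt hq 4 (by norm_num))
  unfold psiNeg
  have n2 : ∀ m, qpoch ((z ^ m * q) ^ 2) ((z ^ m * q) ^ 2) ≠ 0 := fun m => 
    qpoch_ne (norm_pow_lt (by rw [norm_rot hz]; exact hq) 2 (by norm_num))
  have n20 := n2 0
  have n21 := n2 1
  have n22 := n2 2
  have n23 := n2 3
  have n24 := n2 4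
  have n25 : qpoch ((q ^ 5) ^ 2) ((q ^ 5) ^ 2) ≠ 0 := 
    qpoch_ne (norm_pow_lt (norm_pow_lt hq 5 (by norm_num)) 2 (by norm_num))
  have n225 : qpoch ((q ^ 25) ^ 2) ((q ^ 25) ^ 2) ≠ 0 := 
    qpoch_ne (norm_pow_lt (norm_pow_lt hq 25 (by norm_num)) 2 (by norm_num))
  simp only [pow_zero, one_mul, pow_one, mul_pow, ← pow_mul] at *
  norm_num at *
  calc _ = (qpoch q q * qpoch (z * q) (z * q) * qpoch (z ^ 2 * q) (z ^ 2 * q)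
      * qpoch (z ^ 3 * q) (z ^ 3 * q) * qpoch (z ^ 4 * q) (z ^ 4 * q) * qpoch (q ^ 25) (q ^ 25)) * 
      (qpoch (q ^ 4) (q ^ 4) * qpoch (z ^ 4 * q ^ 4) (z ^ 4 * q ^ 4) * qpoch (z ^ 8 * q ^ 4) (z ^ 8 * q ^ 4)
      * qpoch (z ^ 12 * q ^ 4) (z ^ 12 * q ^ 4) * qpoch (z ^ 16 * q ^ 4) (z ^ 16 * q ^ 4) * qpoch (q ^ 100) (q ^ 100)) /
      (qpoch (q ^ 2) (q ^ 2) * qpoch (z ^ 2 * q ^ 2) (z ^ 2 * q ^ 2) * qpoch (z ^ 4 * q ^ 2) (z ^ 4 * q ^ 2)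
      * qpoch (z ^ 6 * q ^ 2) (z ^ 6 * q ^ 2) * qpoch (z ^ 8 * q ^ 2) (z ^ 8 * q ^ 2) * qpoch (q ^ 50) (q ^ 50)) := by
        simp only [div_mul_div_comm]
        congr 1; ring
    _ = _ := by
        rw [a1, a2, a4, div_pow, mul_pow]
/-- ψ(Q) as a series -/
noncomputable def ps (Q : ℂ) : ℂ := ∑' n : ℕ, Q ^ (n * (n + 1) / 2)

lemma tri_ge (n : ℕ) : n ≤ n * (n + 1) / 2 := by
  rw [Nat.le_div_iff_mul_le (by norm_num)]
  rcases n with _ | n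
  · simp
  · exact Nat.mul_le_mul_left _ (by omega)

lemma ps_summable {Q : ℂ} (hQ : ‖Q‖ < 1) : Summable (fun n : ℕ => Q ^ (n * (n + 1) / 2)) := by
  apply Summable.of_norm_bounded (summable_geometric_of_lt_one (norm_nonneg _) hQ)
  intro n
  rw [norm_pow]
  exact pow_le_pow_of_le_one (norm_nonneg _) hQ.le (tri_ge n)

/-- partial Shanks products -/
noncomputable def SP (Q : ℂ) (n : ℕ) : ℂ :=
  ∏ k ∈ Finset.range n, ((1 - Q ^ (2 * k + 2)) / (1 - Q ^ (2 * k + 1)))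

lemma SP_succ (Q : ℂ) (n : ℕ) :
    SP Q (n + 1) = SP Q n * ((1 - Q ^ (2 * n + 2)) / (1 - Q ^ (2 * n + 1))) := by
  rw [SP, Finset.prod_range_succ, SP]

lemma one_sub_ne' {Q : ℂ} (hQ : ‖Q‖ < 1) (k : ℕ) : 1 - Q ^ (k + 1) ≠ 0 := by
  have := one_sub_ne hQ k
  rwa [pow_succ']

lemma SP_ne {Q : ℂ} (hQ : ‖Q‖ < 1) (n : ℕ) : SP Q n ≠ 0 :=
  Finset.prod_ne_zero_iff.mpr fun _ _ => div_ne_zero (one_sub_ne' hQ _) (one_sub_ne' hQ _)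

lemma shanks_tele {Q : ℂ} (hQ : ‖Q‖ < 1) (n m : ℕ) :
    ∑ s ∈ Finset.range (m + 1), (SP Q (n + 1) / SP Q s * Q ^ (s * (2 * n + 3))
      - SP Q n / SP Q s * Q ^ (s * (2 * n + 1))) =
    (1 - Q ^ (2 * m + 1)) * (SP Q n / SP Q m) * Q ^ ((m + 1) * (2 * n + 1)) / (1 - Q ^ (2 * n + 1)) := by
  have hn := one_sub_ne' hQ (2 * n)
  have hSn := SP_ne hQ n
  induction m with
  | zero =>
    simp [SP_succ]
    have h0 : SP Q 0 = 1 := by simp [SP]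
    rw [h0]
    field_simp
    ring
  | succ m ih =>
    rw [Finset.sum_range_succ, ih]
    have hSm := SP_ne hQ m
    have h1 := one_sub_ne' hQ (2 * m)
    have h2 := one_sub_ne' hQ (2 * m + 1)
    simp only [SP_succ]
    field_simp
    ring

lemma tri_even (n : ℕ) : (2 * n) * (2 * n + 1) / 2 = n * (2 * n + 1) := by
  rw [show (2 * n) * (2 * n + 1) = 2 * (n * (2 * n + 1)) by ring]; simp
lemma tri_odd (n : ℕ) : (2 * n + 1) * (2 * n + 1 + 1) / 2 = (n + 1) * (2 * n + 1) := by
  rw [show (2 * n + 1) * (2 * n + 1 + 1) = 2 * ((n + 1) * (2 * n + 1)) by ring]; simp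

lemma shanks {Q : ℂ} (hQ : ‖Q‖ < 1) (n : ℕ) :
    ∑ s ∈ Finset.range n, SP Q n / SP Q s * Q ^ (s * (2 * n + 1)) =
    ∑ s ∈ Finset.range (2 * n), Q ^ (s * (s + 1) / 2) := by
  induction n with
  | zero => simp
  | succ n ih =>
    have h1 := one_sub_ne' hQ (2 * n)
    rw [show 2 * (n + 1) = 2 * n + 1 + 1 by ring, Finset.sum_range_succ _ (2 * n + 1),
      Finset.sum_range_succ _ (2 * n), ← ih, tri_even, tri_odd]
    have hSn := SP_ne hQ n
    rcases n with _ | m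
    · simp [SP_succ]
      have h0 : SP Q 0 = 1 := by simp [SP]
      rw [h0]
      simp at h1
      field_simp
      ring
    · have h2 := one_sub_ne' hQ (2 * m)
      have h3 := one_sub_ne' hQ (2 * m + 1)
      have t := shanks_tele hQ (m + 1) m
      rw [Finset.sum_sub_distrib, sub_eq_iff_eq_add] at t
      rw [Finset.sum_range_succ]
      rw [show 2 * (m + 1) + 1 + 1 + 1 = 2 * (m + 1) + 3 by ring, t]
      rw [SP_succ Q (m + 1)]
      have e : SP Q (m + 1) / SP Q m = (1 - Q ^ (2 * m + 2)) / (1 - Q ^ (2 * m + 1)) := by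
        rw [SP_succ]; have := SP_ne hQ m; field_simp
      rw [e]
      field_simp
      ring

lemma SP_EP {q : ℂ} (hq : ‖q‖ < 1) (n : ℕ) :
    SP (-q) n = EP q (2 * n) * EP (q ^ 4) n / EP (q ^ 2) (2 * n) := by
  induction n with
  | zero => simp [SP, EP]
  | succ n ih =>
    rw [SP_succ, ih, show 2 * (n + 1) = 2 * n + 1 + 1 by ring]
    simp only [EP_succ]
    have h1 := EP_ne (norm_pow_lt hq 2 (by norm_num)) (2 * n)
    have h2 := one_sub_ne (norm_pow_lt hq 2 (by norm_num)) (2 * n)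
    have h3 := one_sub_ne (norm_pow_lt hq 2 (by norm_num)) (2 * n + 1)
    have h4 := one_sub_ne' (Q := -q) (by simpa using hq) (2 * n)
    have e1 : (-q) ^ (2 * n + 1) = - q ^ (2 * n + 1) := by rw [Odd.neg_pow ⟨n, rfl⟩]
    have e2 : (-q) ^ (2 * n + 2) = q ^ (2 * n + 2) := by rw [Even.neg_pow ⟨n + 1, by ring⟩]
    rw [e1] at h4
    rw [e1, e2]
    rw [div_mul_div_comm, div_eq_div_iff (mul_ne_zero h1 h4) (mul_ne_zero (mul_ne_zero h1 h2) h3)]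
    ring

lemma SP_tendsto {q : ℂ} (hq : ‖q‖ < 1) :
    Filter.Tendsto (SP (-q)) Filter.atTop (nhds (psiNeg q)) := by
  have h2 : Filter.Tendsto (fun n : ℕ => 2 * n) Filter.atTop Filter.atTop :=
    Filter.tendsto_id.const_mul_atTop' (by norm_num)
  have := (((EP_tendsto hq).comp h2).mul (EP_tendsto (norm_pow_lt hq 4 (by norm_num)))).div
    ((EP_tendsto (norm_pow_lt hq 2 (by norm_num))).comp h2)
    (qpoch_ne (norm_pow_lt hq 2 (by norm_num)))
  exact this.congr fun n => (SP_EP hq n).symm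

lemma psiNeg_eq {q : ℂ} (hq : ‖q‖ < 1) : psiNeg q = ps (-q) := by
  have hQ : ‖-q‖ < 1 := by simpa using hq
  have hr : 0 ≤ ‖-q‖ := norm_nonneg _
  have tS := SP_tendsto hq
  have tI := tS.inv₀ (psiNeg_ne hq)
  have h2 : Filter.Tendsto (fun n : ℕ => 2 * n) Filter.atTop Filter.atTop :=
    Filter.tendsto_id.const_mul_atTop' (by norm_num)
  have tR := (ps_summable hQ).hasSum.tendsto_sum_nat.comp h2
  obtain ⟨M, hM⟩ := tS.norm.bddAbove_range
  obtain ⟨M', hM'⟩ := tI.norm.bddAbove_range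
  have hM : ∀ n, ‖SP (-q) n‖ ≤ M := fun n => hM ⟨n, rfl⟩
  have hM' : ∀ n, ‖(SP (-q) n)⁻¹‖ ≤ M' := fun n => hM' ⟨n, rfl⟩
  have hMn : 0 ≤ M := (norm_nonneg _).trans (hM 0)
  have key : Filter.Tendsto (fun n => ∑ s ∈ Finset.range (2 * (n+1)), (-q) ^ (s * (s + 1) / 2)
      - SP (-q) (n+1)) Filter.atTop (nhds 0) := by
    have hb : Filter.Tendsto (fun n : ℕ => M * M' * (n * ‖-q‖ ^ n)) Filter.atTop (nhds 0) := by
      have := (tendsto_self_mul_const_pow_of_lt_one hr hQ).const_mul (M * M')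
      simpa using this
    apply squeeze_zero_norm _ hb
    intro n
    rw [← shanks hQ, Finset.sum_range_succ']
    have h0 : SP (-q) 0 = 1 := by simp [SP]
    simp only [h0, zero_mul, pow_zero, div_one, mul_one, add_sub_cancel_right]
    calc _ ≤ ∑ s ∈ Finset.range n, ‖SP (-q) (n + 1) / SP (-q) (s + 1) * (-q) ^ ((s + 1) * (2 * (n + 1) + 1))‖ :=
          norm_sum_le _ _
      _ ≤ ∑ s ∈ Finset.range n, M * M' * ‖-q‖ ^ n := by
          apply Finset.sum_le_sum
          intro s _
          rw [div_eq_mul_inv, norm_mul, norm_mul, norm_pow]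
          apply mul_le_mul (mul_le_mul (hM _) (hM' _) (norm_nonneg _) hMn) _ (by positivity) _
          · apply pow_le_pow_of_le_one hr hQ.le
            nlinarith
          · exact mul_nonneg hMn ((norm_nonneg _).trans (hM' 0))
      _ = _ := by simp; ring
  have t1 := (Filter.tendsto_add_atTop_iff_nat 1).mpr tR
  have t2 := (Filter.tendsto_add_atTop_iff_nat 1).mpr tS
  have := tendsto_nhds_unique (t1.sub t2) key
  rw [ps]
  linear_combination -this
/-- integer triangular numbers -/
def TZ (n : ℤ) : ℤ := n * (n + 1) / 2

lemma TZ2 (n : ℤ) : 2 * TZ n = n * (n + 1) :=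
  Int.mul_ediv_cancel' (Int.even_mul_succ_self n).two_dvd

/-- exponent of the theta function `a` -/
def EA (n : ℤ) : ℤ := n * (5 * n + 1) / 2
/-- exponent of the theta function `b` -/
def EB (n : ℤ) : ℤ := n * (5 * n + 3) / 2

lemma EA2 (n : ℤ) : 2 * EA n = n * (5 * n + 1) := by
  apply Int.mul_ediv_cancel'
  rcases Int.even_or_odd' n with ⟨k, rfl | rfl⟩
  · exact ⟨k * (5 * (2 * k) + 1), by ring⟩
  · exact ⟨(2 * k + 1) * (5 * k + 3), by ring⟩

lemma EB2 (n : ℤ) : 2 * EB n = n * (5 * n + 3) := by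
  apply Int.mul_ediv_cancel'
  rcases Int.even_or_odd' n with ⟨k, rfl | rfl⟩
  · exact ⟨k * (5 * (2 * k) + 3), by ring⟩
  · exact ⟨(2 * k + 1) * (5 * k + 4), by ring⟩

/-- `f(Q²,Q³)` -/
noncomputable def ta (Q : ℂ) : ℂ := ∑' n : ℤ, Q ^ EA n
/-- `f(Q,Q⁴)` -/
noncomputable def tb (Q : ℂ) : ℂ := ∑' n : ℤ, Q ^ EB n

lemma TZ_nat (n : ℕ) : TZ n = ((n * (n + 1) / 2 : ℕ) : ℤ) := by
  simp [TZ]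

lemma TZ_neg (n : ℤ) : TZ (-(n + 1)) = TZ n := by
  have := TZ2 n
  have := TZ2 (-(n + 1))
  have : 2 * TZ (-(n + 1)) = 2 * TZ n := by linarith
  omega

lemma hasSum_T {Q : ℂ} (hQ : ‖Q‖ < 1) : HasSum (fun n : ℤ => Q ^ TZ n) (2 * ps Q) := by
  have h := (ps_summable hQ).hasSum
  rw [two_mul]
  apply HasSum.of_nat_of_neg_add_one
  · simp only [TZ_nat, zpow_natCast]
    exact h
  · simp only [TZ_neg, TZ_nat, zpow_natCast]
    exact h

lemma summable_T {Q : ℂ} (hQ : ‖Q‖ < 1) : Summable (fun n : ℤ => ‖Q ^ TZ n‖) := by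
  have := (hasSum_T hQ).summable
  exact this.norm

lemma summable_A {Q : ℂ} (h0 : Q ≠ 0) (hQ : ‖Q‖ < 1) : Summable (fun n : ℤ => Q ^ EA n) := by
  have h0' : 0 < ‖Q‖ := norm_pos_iff.mpr h0
  apply Summable.of_norm_bounded (summable_T hQ)
  intro n
  rw [norm_zpow, norm_zpow]
  apply zpow_le_zpow_right_of_le_one₀ h0' hQ.le
  have := TZ2 n
  have := EA2 n
  nlinarith [sq_nonneg n]

lemma summable_B {Q : ℂ} (h0 : Q ≠ 0) (hQ : ‖Q‖ < 1) : Summable (fun n : ℤ => Q ^ EB n) := by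
  have h0' : 0 < ‖Q‖ := norm_pos_iff.mpr h0
  apply Summable.of_norm_bounded (summable_T hQ)
  intro n
  rw [norm_zpow, norm_zpow]
  apply zpow_le_zpow_right_of_le_one₀ h0' hQ.le
  have := TZ2 n
  have := EB2 n
  have : 0 ≤ n * (2 * n + 1) := by
    rcases lt_or_ge n 0 with h | h
    · nlinarith
    · positivity
  nlinarith

lemma tsum_split {β γ : Type} (e : Fin 5 × β ≃ γ) {f : γ → ℂ} (hf : Summable f) :
    ∑' x, f x = ∑' y, f (e (0, y)) + ∑' y, f (e (1, y)) + ∑' y, f (e (2, y))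
      + ∑' y, f (e (3, y)) + ∑' y, f (e (4, y)) := by
  rw [← e.tsum_eq f, Summable.tsum_prod (f := fun c => f (e c)) ((e.summable_iff (f := f)).mpr hf), tsum_fintype, Fin.sum_univ_five]

/-- residues -/
def eZ : Fin 5 × ℤ ≃ ℤ where
  toFun x := 5 * x.2 + (x.1 : ℕ)
  invFun n := (⟨(n % 5).toNat, by omega⟩, n / 5)
  left_inv := by
    rintro ⟨r, k⟩
    ext
    · simp; omega
    · simp; omega
  right_inv := by
    intro n
    simp; omega

/-- residues in the plane -/
def eZZ : Fin 5 × (ℤ × ℤ) ≃ ℤ × ℤ where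
  toFun x := (5 * x.2.1 + (x.1 : ℕ) + 2 * x.2.2, x.2.2)
  invFun n := (⟨((n.1 - 2 * n.2) % 5).toNat, by omega⟩, (n.1 - 2 * n.2) / 5, n.2)
  left_inv := by
    rintro ⟨r, k⟩
    ext
    · simp; omega
    · simp; omega
    · simp
  right_inv := by
    intro n
    ext
    · simp; omega
    · simp

lemma dissect {Q : ℂ} (h0 : Q ≠ 0) (hQ : ‖Q‖ < 1) :
    ps Q = ta (Q ^ 5) + Q * tb (Q ^ 5) + Q ^ 3 * ps (Q ^ 25) := by
  have h := (hasSum_T hQ).tsum_eq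
  rw [tsum_split eZ (hasSum_T hQ).summable] at h
  have hc := (hasSum_T (norm_pow_lt hQ 25 (by norm_num))).tsum_eq
  have a0 : ∑' y, Q ^ TZ (eZ (0, y)) = ta (Q ^ 5) := by
    unfold ta
    refine tsum_congr fun k => ?_
    rw [← zpow_natCast, ← zpow_mul]
    congr 1
    simp [eZ]
    have := TZ2 (5 * k)
    have := EA2 k
    nlinarith
  have a4 : ∑' y, Q ^ TZ (eZ (4, y)) = ta (Q ^ 5) := by
    unfold ta
    rw [← (Equiv.subLeft (-1 : ℤ)).tsum_eq (fun n => (Q ^ 5) ^ EA n)]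
    refine tsum_congr fun k => ?_
    rw [← zpow_natCast, ← zpow_mul]
    congr 1
    simp [eZ]
    have := TZ2 (5 * k + 4)
    have := EA2 (-1 - k)
    nlinarith
  have a1 : ∑' y, Q ^ TZ (eZ (1, y)) = Q * tb (Q ^ 5) := by
    unfold tb
    rw [← tsum_mul_left]
    refine tsum_congr fun k => ?_
    rw [← zpow_natCast, ← zpow_mul, ← zpow_one_add₀ h0]
    congr 1
    simp [eZ]
    have := TZ2 (5 * k + 1)
    have := EB2 k
    nlinarith
  have a3 : ∑' y, Q ^ TZ (eZ (3, y)) = Q * tb (Q ^ 5) := by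
    unfold tb
    rw [← (Equiv.subLeft (-1 : ℤ)).tsum_eq (fun n => (Q ^ 5) ^ EB n), ← tsum_mul_left]
    refine tsum_congr fun k => ?_
    rw [← zpow_natCast, ← zpow_mul, ← zpow_one_add₀ h0]
    congr 1
    simp [eZ]
    have := TZ2 (5 * k + 3)
    have := EB2 (-1 - k)
    nlinarith
  have a2 : ∑' y, Q ^ TZ (eZ (2, y)) = Q ^ 3 * (2 * ps (Q ^ 25)) := by
    rw [← hc, ← tsum_mul_left]
    refine tsum_congr fun k => ?_
    rw [← zpow_natCast, ← zpow_natCast, ← zpow_mul, ← zpow_add₀ h0]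
    congr 1
    simp [eZ]
    have := TZ2 (5 * k + 2)
    have := TZ2 k
    nlinarith
  rw [a0, a1, a2, a3, a4] at h
  linear_combination (-1/2) * h

/-- the exponent reindexing, class 0 -/
def g0 : ℤ × ℤ ≃ ℤ × ℤ where
  toFun x := (x.2 + 2 * x.1, -x.1)
  invFun y := (-y.2, y.1 + 2 * y.2)
  left_inv x := by ext <;> simp
  right_inv x := by ext <;> simp
/-- class 4 -/
def g4 : ℤ × ℤ ≃ ℤ × ℤ where
  toFun x := (-x.1 - 1, -2 * x.1 - 2 - x.2)
  invFun y := (-y.1 - 1, 2 * y.1 - y.2)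
  left_inv x := by ext <;> simp <;> ring
  right_inv x := by ext <;> simp <;> ring
/-- class 1 -/
def g1 : ℤ × ℤ ≃ ℤ × ℤ where
  toFun x := (-x.2 - 1 - 2 * x.1, x.1)
  invFun y := (y.2, -y.1 - 1 - 2 * y.2)
  left_inv x := by ext <;> simp <;> ring
  right_inv x := by ext <;> simp <;> ring
/-- class 2 -/
def g2 : ℤ × ℤ ≃ ℤ × ℤ where
  toFun x := (x.1, 2 * x.1 + 1 + x.2)
  invFun y := (y.1, y.2 - 2 * y.1 - 1)
  left_inv x := by ext <;> simp <;> ring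
  right_inv x := by ext <;> simp <;> ring
/-- class 3 -/
def g3 : ℤ × ℤ ≃ ℤ × ℤ where
  toFun x := (x.2 + 2 * x.1 + 1, -x.1 - 1)
  invFun y := (-y.2 - 1, y.1 + 2 * y.2 + 1)
  left_inv x := by ext <;> simp <;> ring
  right_inv x := by ext <;> simp <;> ring

lemma tatb {Q : ℂ} (h0 : Q ≠ 0) (hQ : ‖Q‖ < 1) :
    ta Q * tb Q = ps Q ^ 2 - Q * ps (Q ^ 5) ^ 2 := by
  have hQ5 := norm_pow_lt hQ 5 (by norm_num)
  have sT := (hasSum_T hQ).summable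
  have sT5 := (hasSum_T hQ5).summable
  have sA := summable_A h0 hQ
  have sB := summable_B h0 hQ
  have sTT := summable_mul_of_summable_norm sT.norm sT.norm
  have sBA := summable_mul_of_summable_norm sB.norm sA.norm
  have P1 := tsum_mul_tsum_of_summable_norm sT.norm sT.norm
  have P5 := tsum_mul_tsum_of_summable_norm sT5.norm sT5.norm
  have PBA := tsum_mul_tsum_of_summable_norm sB.norm sA.norm
  rw [(hasSum_T hQ).tsum_eq, tsum_split eZZ sTT] at P1
  rw [(hasSum_T hQ5).tsum_eq] at P5
  change tb Q * ta Q = _ at PBA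
  have c0 : ∑' y, Q ^ TZ (eZZ (0, y)).1 * Q ^ TZ (eZZ (0, y)).2 = tb Q * ta Q := by
    rw [PBA, ← g0.tsum_eq (fun z : ℤ × ℤ => Q ^ EB z.1 * Q ^ EA z.2)]
    refine tsum_congr fun ⟨k, t⟩ => ?_
    rw [← zpow_add₀ h0, ← zpow_add₀ h0]
    congr 1
    simp [eZZ, g0]
    have := TZ2 (5 * k + 2 * t)
    have := TZ2 t
    have := EB2 (t + 2 * k)
    have := EA2 (-k)
    nlinarith
  have c1 : ∑' y, Q ^ TZ (eZZ (1, y)).1 * Q ^ TZ (eZZ (1, y)).2 = tb Q * ta Q := by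
    rw [PBA, ← g1.tsum_eq (fun z : ℤ × ℤ => Q ^ EB z.1 * Q ^ EA z.2)]
    refine tsum_congr fun ⟨k, t⟩ => ?_
    rw [← zpow_add₀ h0, ← zpow_add₀ h0]
    congr 1
    simp [eZZ, g1]
    have := TZ2 (5 * k + 1 + 2 * t)
    have := TZ2 t
    have := EB2 (-t - 1 - 2 * k)
    have := EA2 k
    nlinarith
  have c2 : ∑' y, Q ^ TZ (eZZ (2, y)).1 * Q ^ TZ (eZZ (2, y)).2 = tb Q * ta Q := by
    rw [PBA, ← g2.tsum_eq (fun z : ℤ × ℤ => Q ^ EB z.1 * Q ^ EA z.2)]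
    refine tsum_congr fun ⟨k, t⟩ => ?_
    rw [← zpow_add₀ h0, ← zpow_add₀ h0]
    congr 1
    simp [eZZ, g2]
    have := TZ2 (5 * k + 2 + 2 * t)
    have := TZ2 t
    have := EB2 k
    have := EA2 (2 * k + 1 + t)
    nlinarith
  have c4 : ∑' y, Q ^ TZ (eZZ (4, y)).1 * Q ^ TZ (eZZ (4, y)).2 = tb Q * ta Q := by
    rw [PBA, ← g4.tsum_eq (fun z : ℤ × ℤ => Q ^ EB z.1 * Q ^ EA z.2)]
    refine tsum_congr fun ⟨k, t⟩ => ?_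
    rw [← zpow_add₀ h0, ← zpow_add₀ h0]
    congr 1
    simp [eZZ, g4]
    have := TZ2 (5 * k + 4 + 2 * t)
    have := TZ2 t
    have := EB2 (-k - 1)
    have := EA2 (-(2 * k) - 2 - t)
    nlinarith
  have c3 : ∑' y, Q ^ TZ (eZZ (3, y)).1 * Q ^ TZ (eZZ (3, y)).2
      = Q * (2 * ps (Q ^ 5) * (2 * ps (Q ^ 5))) := by
    rw [P5, ← g3.tsum_eq (fun z : ℤ × ℤ => (Q ^ 5) ^ TZ z.1 * (Q ^ 5) ^ TZ z.2), ← tsum_mul_left]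
    refine tsum_congr fun ⟨k, t⟩ => ?_
    rw [← zpow_natCast, ← zpow_mul, ← zpow_mul, ← zpow_add₀ h0, ← zpow_add₀ h0, ← zpow_one_add₀ h0]
    congr 1
    simp [eZZ, g3]
    have := TZ2 (5 * k + 3 + 2 * t)
    have := TZ2 t
    have := TZ2 (t + 2 * k + 1)
    have := TZ2 (-k - 1)
    nlinarith
  rw [c0, c1, c2, c3, c4] at P1
  linear_combination (-1/4) * P1
lemma ps_eq {Q : ℂ} (hQ : ‖Q‖ < 1) : ps Q = psiNeg (-Q) := by
  rw [psiNeg_eq (by simpa using hQ), neg_neg]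

lemma ps_ne {Q : ℂ} (hQ : ‖Q‖ < 1) : ps Q ≠ 0 := by
  rw [ps_eq hQ]; exact psiNeg_ne (by simpa using hQ)

lemma norm_ps {z : ℂ} (hz : IsPrimitiveRoot z 5) {Q : ℂ} (hQ : ‖Q‖ < 1) :
    (ps Q * ps (z * Q) * ps (z ^ 2 * Q) * ps (z ^ 3 * Q) * ps (z ^ 4 * Q)) * ps (Q ^ 25)
      = ps (Q ^ 5) ^ 6 := by
  have h := normPsi hz (q := -Q) (by simpa using hQ)
  have e : ∀ m, psiNeg (z ^ m * -Q) = ps (z ^ m * Q) := fun m => by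
    rw [ps_eq (by rw [norm_rot hz]; exact hQ), mul_neg]
  have e1 := e 1
  rw [pow_one] at e1
  rw [← ps_eq hQ, e1, e, e, e, Odd.neg_pow (by decide), Odd.neg_pow (by decide),
    ← ps_eq (norm_pow_lt hQ 25 (by norm_num)), ← ps_eq (norm_pow_lt hQ 5 (by norm_num))] at h
  exact h

lemma ps_rot {z : ℂ} (hz : IsPrimitiveRoot z 5) {Q : ℂ} (h0 : Q ≠ 0) (hQ : ‖Q‖ < 1) (m : ℕ) :
    ps (z ^ m * Q) = ta (Q ^ 5) + z ^ m * (Q * tb (Q ^ 5)) + (z ^ m) ^ 3 * (Q ^ 3 * ps (Q ^ 25)) := by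
  have hz5 : z ^ 5 = 1 := hz.pow_eq_one
  have hw : (z ^ m) ^ 5 = 1 := by rw [← pow_mul, mul_comm, pow_mul, hz5, one_pow]
  have hw25 : (z ^ m) ^ 25 = 1 := by
    rw [show (z ^ m) ^ 25 = ((z ^ m) ^ 5) ^ 5 by ring, hw, one_pow]
  rw [dissect (mul_ne_zero (pow_ne_zero _ (hz.ne_zero (by norm_num))) h0)
    (by rw [norm_rot hz]; exact hQ)]
  simp only [mul_pow _ Q, hw, hw25, one_mul]
  ring

lemma zpows {z : ℂ} (hw : 1 + z + z ^ 2 + z ^ 3 + z ^ 4 = 0) (n : ℕ) : z ^ (n + 5) = z ^ n := by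
  have h5 : z ^ 5 = 1 := by linear_combination (z - 1) * hw
  rw [pow_add, h5, mul_one]

set_option maxHeartbeats 1000000 in
lemma cyc_id1 {z : ℂ} (hw : 1 + z + z ^ 2 + z ^ 3 + z ^ 4 = 0) (A Y Z : ℂ) :
    (A + z * Y + z ^ 3 * Z) * (A + z ^ 2 * Y + z * Z) * (A + z ^ 3 * Y + z ^ 4 * Z)
      * (A + z ^ 4 * Y + z ^ 2 * Z)
    + z ^ 3 * ((A + Y + Z) * (A + z ^ 2 * Y + z * Z) * (A + z ^ 3 * Y + z ^ 4 * Z)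
      * (A + z ^ 4 * Y + z ^ 2 * Z))
    + z * ((A + Y + Z) * (A + z * Y + z ^ 3 * Z) * (A + z ^ 3 * Y + z ^ 4 * Z)
      * (A + z ^ 4 * Y + z ^ 2 * Z))
    + z ^ 4 * ((A + Y + Z) * (A + z * Y + z ^ 3 * Z) * (A + z ^ 2 * Y + z * Z)
      * (A + z ^ 4 * Y + z ^ 2 * Z))
    + z ^ 2 * ((A + Y + Z) * (A + z * Y + z ^ 3 * Z) * (A + z ^ 2 * Y + z * Z)
      * (A + z ^ 3 * Y + z ^ 4 * Z))
    = 5 * (A ^ 2 * Y ^ 2 - 3 * A * Y * Z ^ 2 + Z ^ 4) := by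
  have h5 : z ^ 5 = 1 := by simpa using zpows hw 0
  have h6 : z ^ 6 = z := by simpa using zpows hw 1
  have h7 := zpows hw 2
  have h8 := zpows hw 3
  have h9 := zpows hw 4
  have h10 := (zpows hw 5).trans h5
  have h11 := (zpows hw 6).trans h6
  have h12 := (zpows hw 7).trans h7
  have h13 := (zpows hw 8).trans h8
  have h14 := (zpows hw 9).trans h9
  have h15 := (zpows hw 10).trans h10
  norm_num at h7 h8 h9 h10 h11 h12 h13 h14 h15
  ring_nf
  simp only [h5, h6, h7, h8, h9, h10, h11, h12, h13, h14, h15]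
  have h4 : z ^ 4 = -1 - z - z ^ 2 - z ^ 3 := by linear_combination hw
  rw [h4]
  ring

set_option maxHeartbeats 1000000 in
lemma cyc_id2 {z : ℂ} (hw : 1 + z + z ^ 2 + z ^ 3 + z ^ 4 = 0) (A Y Z s Q : ℂ) :
    (s * (A + Y + Z) ^ 3 - 5 * Q * (A + Y + Z) * s ^ 3)
    + z * (s * (A + z * Y + z ^ 3 * Z) ^ 3 - 5 * (z * Q) * (A + z * Y + z ^ 3 * Z) * s ^ 3)
    + z ^ 2 * (s * (A + z ^ 2 * Y + z * Z) ^ 3 - 5 * (z ^ 2 * Q) * (A + z ^ 2 * Y + z * Z) * s ^ 3)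
    + z ^ 3 * (s * (A + z ^ 3 * Y + z ^ 4 * Z) ^ 3
      - 5 * (z ^ 3 * Q) * (A + z ^ 3 * Y + z ^ 4 * Z) * s ^ 3)
    + z ^ 4 * (s * (A + z ^ 4 * Y + z ^ 2 * Z) ^ 3
      - 5 * (z ^ 4 * Q) * (A + z ^ 4 * Y + z ^ 2 * Z) * s ^ 3)
    = 5 * (s * (6 * A * Y * Z + Z ^ 3) - 5 * Q * s ^ 3 * Z) := by
  have h5 : z ^ 5 = 1 := by simpa using zpows hw 0
  have h6 : z ^ 6 = z := by simpa using zpows hw 1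
  have h7 := zpows hw 2
  have h8 := zpows hw 3
  have h9 := zpows hw 4
  have h10 := (zpows hw 5).trans h5
  have h11 := (zpows hw 6).trans h6
  have h12 := (zpows hw 7).trans h7
  have h13 := (zpows hw 8).trans h8
  have h14 := (zpows hw 9).trans h9
  have h15 := (zpows hw 10).trans h10
  have h16 := (zpows hw 11).trans h11
  norm_num at h7 h8 h9 h10 h11 h12 h13 h14 h15 h16
  ring_nf
  simp only [h5, h6, h7, h8, h9, h10, h11, h12, h13, h14, h15, h16]
  have h4 : z ^ 4 = -1 - z - z ^ 2 - z ^ 3 := by linear_combination hw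
  rw [h4]
  ring

/-- extraction of an arithmetic progression -/
lemma avg {z : ℂ} (hz : IsPrimitiveRoot z 5) {c : ℕ → ℂ} {F : ℂ → ℂ} 
    (hF : ∀ q : ℂ, ‖q‖ < 1 → HasSum (fun n => c n * q ^ n) (F q))
    (r : ℕ) (hr : r < 5) {p : ℂ} (hp : ‖p‖ < 1) :
    HasSum (fun m => 5 * p ^ r * (c (5 * m + r) * (p ^ 5) ^ m))
     (F p + z ^ (5 - r) * F (z * p) + (z ^ 2) ^ (5 - r) * F (z ^ 2 * p)
      + (z ^ 3) ^ (5 - r) * F (z ^ 3 * p) + (z ^ 4) ^ (5 - r) * F (z ^ 4 * p)) := by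
  have hz5 : z ^ 5 = 1 := hz.pow_eq_one
  have hm : ∀ m, HasSum (fun n => (z ^ m) ^ (5 - r) * (c n * (z ^ m * p) ^ n))
      ((z ^ m) ^ (5 - r) * F (z ^ m * p)) := fun m =>
    (hF _ (by rw [norm_rot hz]; exact hp)).mul_left _
  have h := ((((hm 0).add (hm 1)).add (hm 2)).add (hm 3)).add (hm 4)
  simp only [pow_zero, one_pow, one_mul, pow_one] at h
  have inj : Function.Injective (fun m : ℕ => 5 * m + r) := fun a b hab => by
    simp at hab; exact hab
  rw [← Function.Injective.hasSum_iff inj] at h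
  · convert h using 2 with m
    simp only [Function.comp]
    have e : ∀ w : ℂ, w ^ 5 = 1 → w ^ (5 - r) * (c (5 * m + r) * (w * p) ^ (5 * m + r))
        = p ^ r * (c (5 * m + r) * (p ^ 5) ^ m) := by
      intro w hw
      have : w ^ (5 - r) * w ^ (5 * m + r) = 1 := by
        rw [← pow_add, show 5 - r + (5 * m + r) = 5 * (m + 1) by omega, pow_mul, hw, one_pow]
      rw [mul_pow, show p ^ (5 * m + r) = p ^ r * (p ^ 5) ^ m by ring]
      linear_combination (c (5 * m + r) * p ^ r * (p ^ 5) ^ m) * this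
    have ez : ∀ j, (z ^ j) ^ 5 = 1 := fun j => by rw [← pow_mul, mul_comm, pow_mul, hz5, one_pow]
    have e0 := e 1 (one_pow 5)
    simp only [one_pow, one_mul] at e0
    rw [e0, e z hz5, e _ (ez 2), e _ (ez 3), e _ (ez 4)]
    ring
  · intro n hn
    have hnr : ¬ 5 ∣ (5 - r + n) := by
      intro hd
      apply hn
      refine ⟨n / 5, ?_⟩
      simp only
      omega
    have hc := cyc (hz.pow_of_coprime (5 - r + n) (by
      rw [Nat.coprime_comm]
      exact (Nat.Prime.coprime_iff_not_dvd (by norm_num)).mpr hnr))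
    have : ∀ w : ℂ, w ^ (5 - r) * (c n * (w * p) ^ n) = c n * p ^ n * w ^ (5 - r + n) := by
      intro w; rw [mul_pow, pow_add]; ring
    rw [this, this, this, this, ← pow_mul, ← pow_mul, ← pow_mul, mul_comm 2, mul_comm 3, mul_comm 4,
      pow_mul, pow_mul, pow_mul]
    linear_combination (c n * p ^ n) * hc

lemma fifth_root {q : ℂ} (h0 : q ≠ 0) (hq : ‖q‖ < 1) : ∃ p : ℂ, p ≠ 0 ∧ ‖p‖ < 1 ∧ p ^ 5 = q := by
  obtain ⟨p, hp⟩ := IsAlgClosed.exists_pow_nat_eq q (n := 5) (by norm_num)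
  refine ⟨p, ?_, ?_, hp⟩
  · rintro rfl; simp at hp; exact h0 hp.symm
  · by_contra! h
    have := one_le_pow₀ h (n := 5)
    rw [← norm_pow, hp] at this
    linarith

lemma coeff_zero {d : ℕ → ℂ} (hd : ∀ q : ℂ, ‖q‖ < 1 → Summable (fun n => d n * q ^ n))
    (h : ∀ q : ℂ, q ≠ 0 → ‖q‖ < 1 → ∑' n, d n * q ^ n = 0) (n : ℕ) : d n = 0 := by
  set f : ℂ → ℂ := fun q => ∑' n, d n * q ^ n
  set P := FormalMultilinearSeries.ofScalars ℂ d
  have hball : ∀ᶠ q : ℂ in nhds 0, ‖q‖ < 1 := by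
    filter_upwards [Metric.ball_mem_nhds (0 : ℂ) one_pos] with q hq
    simpa using hq
  have hP : HasFPowerSeriesAt f P 0 := by
    rw [hasFPowerSeriesAt_iff]
    filter_upwards [hball] with q hq
    have := (hd q hq).hasSum
    simpa [f, P, FormalMultilinearSeries.coeff_ofScalars, mul_comm] using this
  have hz : f =ᶠ[nhdsWithin 0 {0}ᶜ] (fun _ => 0) := by
    filter_upwards [self_mem_nhdsWithin, hball.filter_mono nhdsWithin_le_nhds] with q h1 h2
    exact h q h1 h2
  have hz' : f =ᶠ[nhds 0] (fun _ => 0) :=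
    (hP.continuousAt.eventuallyEq_nhds_iff_eventuallyEq_nhdsNE continuousAt_const).mp hz
  have := (hP.congr hz').eq_zero
  have h2 : P.coeff n = 0 := by rw [this]; rfl
  simpa [P, FormalMultilinearSeries.coeff_ofScalars] using h2
lemma hasSum_of {f g : ℕ → ℂ} {a b : ℂ} (h : HasSum f a) (hf : ∀ n, g n = f n) (hab : b = a) :
    HasSum g b := by
  rw [hab, funext hf]; exact h

lemma stepOne {z : ℂ} (hz : IsPrimitiveRoot z 5) {c : ℕ → ℂ}
    (hc : ∀ Q : ℂ, ‖Q‖ < 1 → HasSum (fun n => c n * Q ^ n) (ps (Q ^ 5) ^ 5 / ps Q))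
    {Q : ℂ} (h0 : Q ≠ 0) (hQ : ‖Q‖ < 1) :
    HasSum (fun m => c (5 * m + 2) * Q ^ m)
      (ps (Q ^ 5) * ps Q ^ 3 - 5 * Q * ps Q * ps (Q ^ 5) ^ 3
        + 5 * Q ^ 2 * (ps (Q ^ 5) ^ 5 / ps Q)) := by
  obtain ⟨p, hp0, hp, rfl⟩ := fifth_root h0 hQ
  have hz5 : z ^ 5 = 1 := hz.pow_eq_one
  have h := avg hz hc 2 (by norm_num) hp
  have h' := h.mul_left ((5 * p ^ 2)⁻¹)
  have hp2 : 5 * p ^ 2 ≠ 0 := mul_ne_zero (by norm_num) (pow_ne_zero _ hp0)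
  refine hasSum_of h' (fun m => ?_) ?_
  · field_simp
  have hX : ∀ m, ps (z ^ m * p) ≠ 0 := fun m => ps_ne (by rw [norm_rot hz]; exact hp)
  have R0 := ps_rot hz hp0 hp 0
  have R1 := ps_rot hz hp0 hp 1
  have R2 := ps_rot hz hp0 hp 2
  have R3 := ps_rot hz hp0 hp 3
  have R4 := ps_rot hz hp0 hp 4
  have n0 := hX 0
  have n1 := hX 1
  have n2 := hX 2
  have n3 := hX 3
  have n4 := hX 4
  have N := norm_ps hz hp
  have T := tatb h0 hQ
  have nS := ps_ne hQ
  have nC := ps_ne (norm_pow_lt hp 25 (by norm_num))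
  have cy := cyc hz
  have z6 : (z ^ 2) ^ 3 = z := by linear_combination z * hz5
  have z9 : (z ^ 3) ^ 3 = z ^ 4 := by linear_combination z ^ 4 * hz5
  have z12 : (z ^ 4) ^ 3 = z ^ 2 := by linear_combination (z ^ 7 + z ^ 2) * hz5
  have I := cyc_id1 cy (ta (p ^ 5)) (p * tb (p ^ 5)) (p ^ 3 * ps (p ^ 25))
  simp only [pow_zero, one_mul, pow_one, one_pow, z6, z9, z12] at R0 R1 R2 R3 R4 n0 n1 n2 n3 n4 I
  rw [← R0, ← R1, ← R2, ← R3, ← R4] at I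
  have e25 : (p ^ 5) ^ 5 = p ^ 25 := by ring
  have e1 : (z * p) ^ 5 = p ^ 5 := by rw [mul_pow, hz5, one_mul]
  have e2 : (z ^ 2 * p) ^ 5 = p ^ 5 := by linear_combination p ^ 5 * (z ^ 5 + 1) * hz5
  have e3 : (z ^ 3 * p) ^ 5 = p ^ 5 := by linear_combination p ^ 5 * (z ^ 10 + z ^ 5 + 1) * hz5
  have e4 : (z ^ 4 * p) ^ 5 = p ^ 5 := by
    linear_combination p ^ 5 * (z ^ 15 + z ^ 10 + z ^ 5 + 1) * hz5
  simp only [show 5 - 2 = 3 from rfl]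
  rw [z6, z9, z12, e1, e2, e3, e4]
  rw [e25] at T ⊢
  clear R0 R1 R2 R3 R4 hc h h' hX e1 e2 e3 e4 e25 z6 z9 z12
  generalize ps p = X0 at *
  generalize ps (z * p) = X1 at *
  generalize ps (z ^ 2 * p) = X2 at *
  generalize ps (z ^ 3 * p) = X3 at *
  generalize ps (z ^ 4 * p) = X4 at *
  generalize ps (p ^ 25) = C at *
  generalize ps (p ^ 5) = S at *
  generalize ta (p ^ 5) = A at *
  generalize tb (p ^ 5) = B at *
  have J : S ^ 5 / X0 + z ^ 3 * (S ^ 5 / X1) + z * (S ^ 5 / X2) + z ^ 4 * (S ^ 5 / X3)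
      + z ^ 2 * (S ^ 5 / X4) = S ^ 5 * (5 * (A ^ 2 * (p * B) ^ 2 - 3 * A * (p * B) * (p ^ 3 * C) ^ 2 +
        (p ^ 3 * C) ^ 4)) / (X0 * X1 * X2 * X3 * X4) := by
    rw [← I]; field_simp
  have hN : X0 * X1 * X2 * X3 * X4 = S ^ 6 / C := by field_simp; exact N
  rw [J, hN]
  have AB2 : A ^ 2 * (p * B) ^ 2 = p ^ 2 * (S ^ 2 - p ^ 5 * C ^ 2) ^ 2 := by rw [← T]; ring
  have AB1 : A * (p * B) = p * (S ^ 2 - p ^ 5 * C ^ 2) := by rw [← T]; ring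
  rw [mul_assoc 3 A, AB2, AB1]
  field_simp
  ring

lemma stepTwo {z : ℂ} (hz : IsPrimitiveRoot z 5) {k : ℕ → ℂ} {F : ℂ → ℂ}
    (hk : ∀ Q : ℂ, ‖Q‖ < 1 → HasSum (fun n => k n * Q ^ n) (F Q))
    (hF : ∀ Q : ℂ, Q ≠ 0 → ‖Q‖ < 1 → F Q = ps (Q ^ 5) * ps Q ^ 3 - 5 * Q * ps Q * ps (Q ^ 5) ^ 3)
    {Q : ℂ} (h0 : Q ≠ 0) (hQ : ‖Q‖ < 1) :
    HasSum (fun m => k (5 * m + 4) * Q ^ m) (F Q) := by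
  obtain ⟨p, hp0, hp, rfl⟩ := fifth_root h0 hQ
  have hz5 : z ^ 5 = 1 := hz.pow_eq_one
  have hz0 : z ≠ 0 := hz.ne_zero (by norm_num)
  have h := avg hz hk 4 (by norm_num) hp
  have h' := h.mul_left ((5 * p ^ 4)⁻¹)
  have hp4 : 5 * p ^ 4 ≠ 0 := mul_ne_zero (by norm_num) (pow_ne_zero _ hp0)
  refine hasSum_of h' (fun m => ?_) ?_
  · field_simp
  have FF : ∀ m, F (z ^ m * p) = _ := fun m =>
    hF (z ^ m * p) (mul_ne_zero (pow_ne_zero _ hz0) hp0) (by rw [norm_rot hz]; exact hp)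
  have F0 := FF 0
  have F1 := FF 1
  have F2 := FF 2
  have F3 := FF 3
  have F4 := FF 4
  have R0 := ps_rot hz hp0 hp 0
  have R1 := ps_rot hz hp0 hp 1
  have R2 := ps_rot hz hp0 hp 2
  have R3 := ps_rot hz hp0 hp 3
  have R4 := ps_rot hz hp0 hp 4
  have T := tatb h0 hQ
  have cy := cyc hz
  have z6 : (z ^ 2) ^ 3 = z := by linear_combination z * hz5
  have z9 : (z ^ 3) ^ 3 = z ^ 4 := by linear_combination z ^ 4 * hz5
  have z12 : (z ^ 4) ^ 3 = z ^ 2 := by linear_combination (z ^ 7 + z ^ 2) * hz5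
  have I := cyc_id2 cy (ta (p ^ 5)) (p * tb (p ^ 5)) (p ^ 3 * ps (p ^ 25)) (ps (p ^ 5)) p
  have e25 : (p ^ 5) ^ 5 = p ^ 25 := by ring
  have e1 : (z * p) ^ 5 = p ^ 5 := by rw [mul_pow, hz5, one_mul]
  have e2 : (z ^ 2 * p) ^ 5 = p ^ 5 := by linear_combination p ^ 5 * (z ^ 5 + 1) * hz5
  have e3 : (z ^ 3 * p) ^ 5 = p ^ 5 := by linear_combination p ^ 5 * (z ^ 10 + z ^ 5 + 1) * hz5
  have e4 : (z ^ 4 * p) ^ 5 = p ^ 5 := by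
    linear_combination p ^ 5 * (z ^ 15 + z ^ 10 + z ^ 5 + 1) * hz5
  simp only [pow_zero, one_mul, pow_one, one_pow, z6, z9, z12, e1, e2, e3, e4] at F0 F1 F2 F3 F4 R0 R1 R2 R3 R4
  rw [← R0, ← R1, ← R2, ← R3, ← R4, ← F0, ← F1, ← F2, ← F3, ← F4] at I
  simp only [show 5 - 4 = 1 from rfl, pow_one]
  rw [I, hF _ h0 hQ]
  rw [e25] at T ⊢
  field_simp
  linear_combination (-6 * ps (p ^ 5) * ps (p ^ 25)) * T

theorem stmt_10 (b : ℕ → ℤ)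
    (hb : ∀ q : ℂ, ‖q‖ < 1 →
      ∑' n : ℕ, (b n : ℂ) * q ^ n = psiNeg (q ^ 5) ^ 5 / psiNeg q) :
    ∀ n : ℕ, b (25 * n + 72) = 6 * b (5 * n + 12) - 5 * b n := by
  obtain ⟨z, hz⟩ : ∃ z : ℂ, IsPrimitiveRoot z 5 := ⟨_, Complex.isPrimitiveRoot_exp 5 (by norm_num)⟩
  set c : ℕ → ℂ := fun n => (-1) ^ n * b n with hcdef
  have hc : ∀ Q : ℂ, ‖Q‖ < 1 → HasSum (fun n => c n * Q ^ n) (ps (Q ^ 5) ^ 5 / ps Q) := by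
    intro Q hQ
    have h5 := norm_pow_lt hQ 5 (by norm_num)
    have h := hb (-Q) (by simpa using hQ)
    rw [Odd.neg_pow (by decide) Q, ← ps_eq hQ, ← ps_eq h5] at h
    have e : (fun n => (b n : ℂ) * (-Q) ^ n) = fun n => c n * Q ^ n := by
      funext n; rw [hcdef, neg_pow]; ring
    rw [e] at h
    have hne : ps (Q ^ 5) ^ 5 / ps Q ≠ 0 := div_ne_zero (pow_ne_zero _ (ps_ne h5)) (ps_ne hQ)
    have hs : Summable (fun n => c n * Q ^ n) := by
      by_contra hs
      rw [tsum_eq_zero_of_not_summable hs] at h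
      exact hne h.symm
    rw [← h]; exact hs.hasSum
  -- the shifted sequence
  set k : ℕ → ℂ := fun n => c (5 * n + 2) - (if 2 ≤ n then 5 * c (n - 2) else 0) with hkdef
  have hsh : ∀ Q : ℂ, ‖Q‖ < 1 → HasSum (fun n => (if 2 ≤ n then 5 * c (n - 2) else 0) * Q ^ n)
      (5 * Q ^ 2 * (ps (Q ^ 5) ^ 5 / ps Q)) := by
    intro Q hQ
    have := (hc Q hQ).mul_left (5 * Q ^ 2)
    rw [← hasSum_nat_add_iff' 2]
    refine hasSum_of this (fun n => ?_) ?_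
    · simp only [show 2 ≤ n + 2 by omega, if_true, Nat.add_sub_cancel]; ring
    · simp [Finset.sum_range_succ]
  have hk1 : ∀ Q : ℂ, Q ≠ 0 → ‖Q‖ < 1 → HasSum (fun n => k n * Q ^ n)
      (ps (Q ^ 5) * ps Q ^ 3 - 5 * Q * ps Q * ps (Q ^ 5) ^ 3) := by
    intro Q h0 hQ
    have := (stepOne hz hc h0 hQ).sub (hsh Q hQ)
    refine hasSum_of this (fun n => ?_) ?_
    · simp only [hkdef]; ring
    · ring
  have hsum : ∀ Q : ℂ, ‖Q‖ < 1 → Summable (fun n => k n * Q ^ n) := by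
    intro Q hQ
    by_cases h0 : Q = 0
    · subst h0
      apply summable_of_ne_finset_zero (s := {0})
      intro n hn
      simp at hn
      simp [hn]
    · exact (hk1 Q h0 hQ).summable
  have hkF : ∀ Q : ℂ, ‖Q‖ < 1 → HasSum (fun n => k n * Q ^ n) (∑' n, k n * Q ^ n) :=
    fun Q hQ => (hsum Q hQ).hasSum
  have hk2 : ∀ Q : ℂ, Q ≠ 0 → ‖Q‖ < 1 →
      HasSum (fun n => (k (5 * n + 4) - k n) * Q ^ n) 0 := by
    intro Q h0 hQ
    have h1 := stepTwo hz hkF (fun Q h0 hQ => (hk1 Q h0 hQ).tsum_eq) h0 hQ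
    have := h1.sub (hkF Q hQ)
    rw [sub_self] at this
    exact hasSum_of this (fun n => by ring) rfl
  have hz0 : ∀ n, k (5 * n + 4) - k n = 0 := by
    apply coeff_zero
    · intro Q hQ
      by_cases h0 : Q = 0
      · subst h0
        apply summable_of_ne_finset_zero (s := {0})
        intro n hn
        simp at hn
        simp [hn]
      · exact (hk2 Q h0 hQ).summable
    · intro Q h0 hQ
      exact (hk2 Q h0 hQ).tsum_eq
  intro n
  have h := hz0 (n + 2)
  simp only [hkdef, hcdef] at h
  rw [if_pos (by omega), if_pos (by omega), show 5 * (5 * (n + 2) + 4) + 2 = 25 * n + 72 by ring,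
    show 5 * (n + 2) + 4 - 2 = 5 * n + 12 by omega, show 5 * (n + 2) + 2 = 5 * n + 12 by ring,
    show n + 2 - 2 = n by omega] at h
  have s1 : (-1 : ℂ) ^ (25 * n + 72) = (-1) ^ n := by
    rw [show 25 * n + 72 = 2 * (12 * n + 36) + n by ring, pow_add, pow_mul]; simp
  have s2 : (-1 : ℂ) ^ (5 * n + 12) = (-1) ^ n := by
    rw [show 5 * n + 12 = 2 * (2 * n + 6) + n by ring, pow_add, pow_mul]; simp
  rw [s1, s2] at h
  have hu : (-1 : ℂ) ^ n ≠ 0 := pow_ne_zero _ (by norm_num)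
  have : (b (25 * n + 72) : ℂ) = 6 * b (5 * n + 12) - 5 * b n := by
    apply mul_left_cancel₀ hu
    linear_combination h
  exact_mod_cast this
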